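/- Let p ≥ 3 and (β,h) be a p-regular point with unique global maximizer m_* of H = H_{β,h,p}. If X ~ P_{β,h,p}, then as N → ∞, (S_N − N m_*)/√N converges in distribution to a centered Gaussian with variance −1/H''(m_*). -/

import Mathlib

open Real MeasureTheory Filter
open scoped BigOperators Topology

noncomputable section

/-- The spin value (`±1`) of a Boolean coordinate. -/
def spin (b : Bool) : ℝ := if b then 1 else -1

/-- The total magnetization `S_N = ∑ᵢ Xᵢ` of a configuration. -/
def mag {N : ℕ} (x : Fin N → Bool) : ℝ := ∑ i, spin (x i)

/-- The Hamiltonian of the `p`-spin Curie-Weiss model: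
`β N^{1-p} ∑_{i₁,…,i_p} x_{i₁} ⋯ x_{i_p} + h ∑ᵢ xᵢ`. -/
def cwHamiltonian (p N : ℕ) (β h : ℝ) (x : Fin N → Bool) : ℝ :=
  β * (N : ℝ) ^ ((1 : ℤ) - (p : ℤ)) * (∑ i : Fin p → Fin N, ∏ j, spin (x (i j)))
    + h * mag x

/-- The (unnormalized) Gibbs weight of a configuration. -/
def cwWeight (p N : ℕ) (β h : ℝ) (x : Fin N → Bool) : ℝ :=
  Real.exp (cwHamiltonian p N β h x)

/-- The probability of an event `E` under the `p`-spin Curie-Weiss measure `P_{β,h,p}`. -/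
def cwProb (p N : ℕ) (β h : ℝ) (E : Set (Fin N → Bool)) : ℝ :=
  (∑ x : Fin N → Bool, E.indicator (cwWeight p N β h) x) /
    ∑ x : Fin N → Bool, cwWeight p N β h x

/-- Conditional probability of `E` given `A` under the `p`-spin Curie-Weiss measure. -/
def cwCondProb (p N : ℕ) (β h : ℝ) (E A : Set (Fin N → Bool)) : ℝ :=
  cwProb p N β h (E ∩ A) / cwProb p N β h A

/-- The binary entropy function `I(x) = ½[(1+x)log(1+x) + (1-x)log(1-x)]`. -/
def binEnt (x : ℝ) : ℝ := (1/2) * ((1+x) * Real.log (1+x) + (1-x) * Real.log (1-x))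

/-- The function `H_{β,h,p}(x) = βxᵖ + hx - I(x)`. -/
def Hfun (p : ℕ) (β h : ℝ) (x : ℝ) : ℝ := β * x ^ p + h * x - binEnt x

/-- `m` is a global maximizer of `H_{β,h,p}` on `[-1,1]`, lying in `(-1,1)`. -/
def isMaximizer (p : ℕ) (β h m : ℝ) : Prop :=
  m ∈ Set.Ioo (-1 : ℝ) 1 ∧ ∀ x ∈ Set.Icc (-1 : ℝ) 1, Hfun p β h x ≤ Hfun p β h m

/-- `m` is the unique global maximizer of `H_{β,h,p}`. -/
def isUniqueMaximizer (p : ℕ) (β h m : ℝ) : Prop :=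
  isMaximizer p β h m ∧ ∀ m', isMaximizer p β h m' → m' = m

/-- `(β,h)` is a `p`-regular point with unique global maximizer `m`. -/
def pRegular (p : ℕ) (β h m : ℝ) : Prop :=
  isUniqueMaximizer p β h m ∧ iteratedDeriv 2 (Hfun p β h) m < 0

/-- `(β,h)` is a `p`-special point with unique global maximizer `m`. -/
def pSpecial (p : ℕ) (β h m : ℝ) : Prop :=
  isUniqueMaximizer p β h m ∧ iteratedDeriv 2 (Hfun p β h) m = 0

/-- `(β,h)` is a `p`-critical point: `H_{β,h,p}` has more than one global maximizer. -/
def pCritical (p : ℕ) (β h : ℝ) : Prop :=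
  ∃ m₁ m₂, m₁ ≠ m₂ ∧ isMaximizer p β h m₁ ∧ isMaximizer p β h m₂

/-- The probability assigned to a set `S ⊆ ℝ` by the centered Gaussian with variance `v`. -/
def gaussProb (v : ℝ) (S : Set ℝ) : ℝ :=
  ∫ t in S, (Real.sqrt (2 * Real.pi * v))⁻¹ * Real.exp (-t ^ 2 / (2 * v))

/-- The CDF of the centered Gaussian with variance `v`. -/
def gaussCDF (v x : ℝ) : ℝ := gaussProb v (Set.Iic x)

/-- The standard normal CDF `Φ`. -/
def stdNormCDF (x : ℝ) : ℝ := gaussCDF 1 x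

/-- The CDF of the limit law `F` at a `p`-special point, where `c = H⁽⁴⁾(m_*)`:
`dF(x) = (2/Γ(1/4)) (-c/24)^{1/4} exp(c x⁴/24) dx`. -/
def specialCDF (c x : ℝ) : ℝ :=
  ∫ t in Set.Iic x, (2 / Real.Gamma (1/4)) * ((-c) / 24) ^ ((1:ℝ)/4) * Real.exp (c * t ^ 4 / 24)

/-- The inverse hyperbolic tangent `tanh⁻¹(t) = ½ log((1+t)/(1-t))`. -/
def arctanh (t : ℝ) : ℝ := (1/2) * Real.log ((1+t)/(1-t))

/-- The function `g(t) = tanh⁻¹(t)/(p t^{p-1})`, so that the maximum pseudolikelihood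
estimate of `β` is `g(X̄)`. -/
def gMPL (p : ℕ) (t : ℝ) : ℝ := arctanh t / (p * t ^ (p - 1))

/-- The threshold `β*(p) = inf{β ≥ 0 : sup_{x∈[0,1]} H_{β,0,p}(x) > 0}`. -/
def betaStar (p : ℕ) : ℝ := sInf {b : ℝ | 0 ≤ b ∧ ∃ x ∈ Set.Icc (0:ℝ) 1, 0 < Hfun p b 0 x}

/-- The magnetization per site of a configuration of `N` spins with `k` pluses. -/
def meanMag (N k : ℕ) : ℝ := 2 * k / N - 1

/-- The probability that a binomial variable with parameters `N` and `k / N` takes the value `k`. -/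
def binomPeak (N k : ℕ) : ℝ := N.choose k * (k / N : ℝ) ^ k * ((N - k : ℝ) / N) ^ (N - k)

lemma mag_eq_two_mul_card_sub {N : ℕ} (x : Fin N → Bool) :
    mag x = 2 * ((Finset.univ.filter fun i => x i = true).card : ℝ) - N := by
  have h : ∀ i, spin (x i) = 2 * (if x i = true then 1 else 0) - 1 := by
    intro i
    unfold spin
    split_ifs <;> norm_num
  simp only [mag, h, Finset.sum_sub_distrib, ← Finset.mul_sum]
  simp

lemma sum_apply_mag (N : ℕ) (F : ℝ → ℝ) :
    ∑ x : Fin N → Bool, F (mag x) =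
      ∑ k ∈ Finset.range (N + 1), (N.choose k : ℝ) * F (2 * k - N) := by
  have h := Finset.sum_powerset_apply_card (fun k : ℕ => F (2 * k - N))
    (x := (Finset.univ : Finset (Fin N)))
  simp only [Finset.card_univ, Fintype.card_fin, nsmul_eq_mul] at h
  rw [← h]
  refine Finset.sum_nbij' (fun x => Finset.univ.filter fun i => x i = true)
    (fun s i => decide (i ∈ s)) ?_ ?_ ?_ ?_ ?_
  · simp
  · simp
  · intro x _
    ext i
    simp
  · intro s _
    ext i
    simp
  · intro x _
    rw [mag_eq_two_mul_card_sub]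

lemma cwHamiltonian_eq {p N : ℕ} (hN : 0 < N) (β h : ℝ) (x : Fin N → Bool) :
    cwHamiltonian p N β h x = N * (β * (mag x / N) ^ p + h * (mag x / N)) := by
  have hN' : (N : ℝ) ≠ 0 := by positivity
  have hs : ∑ i : Fin p → Fin N, ∏ j, spin (x (i j)) = mag x ^ p := by
    rw [mag, Fintype.sum_pow]
  rw [cwHamiltonian, hs, zpow_sub₀ hN', zpow_one, zpow_natCast, div_pow]
  field_simp

lemma exp_natCast_mul_log (k : ℕ) {y : ℝ} (hy : k ≠ 0 → 0 < y) :
    Real.exp (k * Real.log y) = y ^ k := by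
  rcases Nat.eq_zero_or_pos k with rfl | hk
  · simp
  · rw [Real.exp_nat_mul, Real.exp_log (hy hk.ne')]

lemma binomPeak_eq {N k : ℕ} (hN : 0 < N) (hk : k ≤ N) :
    binomPeak N k = N.choose k * Real.exp (N * binEnt (meanMag N k)) / 2 ^ N := by
  have hN' : (0 : ℝ) < N := by positivity
  have h1 : 1 + meanMag N k = 2 * (k / N) := by unfold meanMag; ring
  have h2 : 1 - meanMag N k = 2 * ((N - k : ℝ) / N) := by
    unfold meanMag; field_simp; ring
  have hsub : (N : ℝ) - k = ((N - k : ℕ) : ℝ) := by rw [Nat.cast_sub hk]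
  have h3 : N * binEnt (meanMag N k) =
      k * Real.log (2 * (k / N)) + (N - k : ℕ) * Real.log (2 * ((N - k : ℝ) / N)) := by
    rw [binEnt, h1, h2, ← hsub]
    field_simp
  rw [h3, Real.exp_add, exp_natCast_mul_log, exp_natCast_mul_log, binomPeak, mul_pow, mul_pow]
  · have : (2 : ℝ) ^ N = 2 ^ k * 2 ^ (N - k) := by rw [← pow_add, Nat.add_sub_cancel' hk]
    rw [this]
    field_simp
  · intro h
    rw [hsub]
    positivity
  · intro h
    positivity

lemma binomPeak_nonneg {N k : ℕ} (hk : k ≤ N) : 0 ≤ binomPeak N k := by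
  have : (0 : ℝ) ≤ N - k := by simpa using hk
  unfold binomPeak
  positivity

lemma binomPeak_le_one {N k : ℕ} (hN : 0 < N) (hk : k ≤ N) : binomPeak N k ≤ 1 := by
  have hN' : (N : ℝ) ≠ 0 := by positivity
  have h0 : (0 : ℝ) ≤ N - k := by simpa using hk
  have h : ((k / N : ℝ) + (N - k : ℝ) / N) ^ N = 1 := by
    rw [← add_div, add_sub_cancel, div_self hN', one_pow]
  rw [add_pow] at h
  rw [← h, binomPeak]
  refine le_trans (le_of_eq ?_) (Finset.single_le_sum
    (f := fun j => (k / N : ℝ) ^ j * ((N - k : ℝ) / N) ^ (N - j) * N.choose j) ?_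
    (Finset.mem_range_succ_iff.2 hk))
  · ring
  · intro i _
    positivity

lemma choose_mul_exp_eq {p N k : ℕ} (hN : 0 < N) (hk : k ≤ N) (β h m : ℝ) :
    N.choose k * Real.exp (N * (β * meanMag N k ^ p + h * meanMag N k)) =
      2 ^ N * Real.exp (N * Hfun p β h m) *
        (binomPeak N k * Real.exp (N * (Hfun p β h (meanMag N k) - Hfun p β h m))) := by
  have : (N : ℝ) * (β * meanMag N k ^ p + h * meanMag N k) = N * Hfun p β h m +
      (N * binEnt (meanMag N k) + N * (Hfun p β h (meanMag N k) - Hfun p β h m)) := by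
    simp only [Hfun]
    ring
  rw [this, Real.exp_add, Real.exp_add, binomPeak_eq hN hk]
  field_simp

lemma factorial_eq_stirlingSeq {n : ℕ} (hn : n ≠ 0) :
    (n.factorial : ℝ) = Stirling.stirlingSeq n * √(2 * n) * (n / Real.exp 1) ^ n := by
  have : 0 < n := Nat.pos_of_ne_zero hn
  rw [Stirling.stirlingSeq]
  field_simp

lemma sqrt_mul_binomPeak_eq {N k : ℕ} (hk : 0 < k) (hkN : k < N) :
    √N * binomPeak N k =
      Stirling.stirlingSeq N / (Stirling.stirlingSeq k * Stirling.stirlingSeq (N - k)) *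
        √(2 / (1 - meanMag N k ^ 2)) := by
  obtain ⟨l, rfl⟩ := Nat.exists_eq_add_of_lt hkN
  set j := l + 1 with hj
  have hj0 : 0 < j := by omega
  rw [show k + l + 1 = k + j by omega]
  have hsqrt : √((k + j : ℕ) : ℝ) * √(2 * (k + j : ℕ)) =
      √(2 / (1 - meanMag (k + j) k ^ 2)) * (√(2 * k) * √(2 * j)) := by
    rw [← Real.sqrt_mul (by positivity), ← Real.sqrt_mul (by positivity),
      ← Real.sqrt_mul' _ (by positivity)]
    congr 1
    have : (1 - meanMag (k + j) k ^ 2) = 4 * k * j / (k + j) ^ 2 := by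
      unfold meanMag
      push_cast
      field_simp
      ring
    rw [this]
    push_cast
    field_simp
    ring
  have hpos : ∀ n : ℕ, 0 < n → 0 < Stirling.stirlingSeq n := by
    intro n hn
    unfold Stirling.stirlingSeq
    positivity
  have h1 := hpos k hk
  have h2 := hpos j hj0
  have hch : ((k + j).choose k : ℝ) = (k + j).factorial / (k.factorial * j.factorial) := by
    rw [Nat.cast_add_choose]
  rw [binomPeak, hch, factorial_eq_stirlingSeq hk.ne', factorial_eq_stirlingSeq hj0.ne',
    factorial_eq_stirlingSeq (n := k + j) (by omega), Nat.add_sub_cancel_left]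
  have h3 : ((k + j : ℕ) : ℝ) - k = j := by push_cast; ring
  rw [h3]
  have hp1 : 0 < √(2 * k : ℝ) := by positivity
  have hp2 : 0 < √(2 * j : ℝ) := by positivity
  rw [← mul_right_cancel_iff_of_pos (mul_pos hp1 hp2), mul_assoc (_ / _) _ (_ * _), ← hsqrt]
  simp only [div_pow, pow_add]
  field_simp

lemma tendsto_sqrt_mul_binomPeak {ι : Type*} {l : Filter ι} {N k : ι → ℕ} {m : ℝ}
    (hm : m ∈ Set.Ioo (-1 : ℝ) 1) (hN : Tendsto N l atTop)
    (hs : Tendsto (fun i => meanMag (N i) (k i)) l (𝓝 m)) :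
    Tendsto (fun i => √(N i) * binomPeak (N i) (k i)) l
      (𝓝 (√π / (√π * √π) * √(2 / (1 - m ^ 2)))) := by
  have hNr : Tendsto (fun i => (N i : ℝ)) l atTop := tendsto_natCast_atTop_atTop.comp hN
  have hN0 : ∀ᶠ i in l, 0 < N i := hN.eventually_gt_atTop 0
  have hk : Tendsto k l atTop := by
    rw [← tendsto_natCast_atTop_iff (R := ℝ)]
    have h1 : Tendsto (fun i => (N i : ℝ) * ((1 + meanMag (N i) (k i)) / 2)) l atTop :=
      hNr.atTop_mul_pos (C := (1 + m) / 2) (by linarith [hm.1])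
        ((hs.const_add 1).div_const 2)
    refine h1.congr' ?_
    filter_upwards [hN0] with i hi
    unfold meanMag
    field_simp
    ring
  have hlt : ∀ᶠ i in l, k i < N i := by
    filter_upwards [hN0, hs.eventually_lt_const hm.2] with i hi h
    have hi' : (0 : ℝ) < N i := by exact_mod_cast hi
    unfold meanMag at h
    have h2 : 2 * (k i : ℝ) / N i < 2 := by linarith
    rw [div_lt_iff₀ hi'] at h2
    have : (k i : ℝ) < N i := by linarith
    exact_mod_cast this
  have hNk : Tendsto (fun i => N i - k i) l atTop := by
    rw [← tendsto_natCast_atTop_iff (R := ℝ)]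
    have h1 : Tendsto (fun i => (N i : ℝ) * ((1 - meanMag (N i) (k i)) / 2)) l atTop :=
      hNr.atTop_mul_pos (C := (1 - m) / 2) (by linarith [hm.2])
        ((hs.const_sub 1).div_const 2)
    refine h1.congr' ?_
    filter_upwards [hN0, hlt] with i hi h
    rw [Nat.cast_sub h.le]
    unfold meanMag
    field_simp
    ring
  have hS := Stirling.tendsto_stirlingSeq_sqrt_pi
  have hpi : √π ≠ 0 := by positivity
  have hm2 : 1 - m ^ 2 ≠ 0 := by nlinarith [hm.1, hm.2]
  refine Tendsto.congr' ?_ (((hS.comp hN).div ((hS.comp hk).mul (hS.comp hNk))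
    (mul_ne_zero hpi hpi)).mul
    ((tendsto_const_nhds.div (tendsto_const_nhds.sub (hs.pow 2)) hm2).sqrt))
  filter_upwards [hlt, hk.eventually_gt_atTop 0] with i hi hi0
  exact (sqrt_mul_binomPeak_eq hi0 hi).symm

lemma hasDerivAt_Hfun (p : ℕ) (β h : ℝ) {x : ℝ} (hx : x ∈ Set.Ioo (-1 : ℝ) 1) :
    HasDerivAt (Hfun p β h)
      (β * (p * x ^ (p - 1)) + h - (Real.log (1 + x) - Real.log (1 - x)) / 2) x := by
  have h1 : 1 + x ≠ 0 := by linarith [hx.1]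
  have h2 : 1 - x ≠ 0 := by linarith [hx.2]
  have ha := (hasDerivAt_id x).const_add 1
  have hb := (hasDerivAt_id x).const_sub 1
  have := (((hasDerivAt_pow p x).const_mul β).add ((hasDerivAt_id x).const_mul h)).sub
    (((ha.mul (ha.log h1)).add (hb.mul (hb.log h2))).const_mul (1 / 2))
  refine (this.congr_deriv ?_ : HasDerivAt (Hfun p β h) _ x)
  simp only [id]
  field_simp
  ring

lemma continuous_Hfun (p : ℕ) (β h : ℝ) : Continuous (Hfun p β h) := by
  have h1 : Continuous fun x : ℝ => (1 + x) * Real.log (1 + x) :=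
    Real.continuous_mul_log.comp (continuous_const.add continuous_id)
  have h2 : Continuous fun x : ℝ => (1 - x) * Real.log (1 - x) :=
    Real.continuous_mul_log.comp (continuous_const.sub continuous_id)
  unfold Hfun binEnt
  fun_prop

lemma contDiffOn_Hfun (p : ℕ) (β h : ℝ) :
    ContDiffOn ℝ 2 (Hfun p β h) (Set.Ioo (-1) 1) := by
  have h1 : ContDiffOn ℝ 2 (fun x : ℝ => Real.log (1 + x)) (Set.Ioo (-1) 1) :=
    ContDiffOn.log (by fun_prop) fun x hx => by linarith [hx.1]
  have h2 : ContDiffOn ℝ 2 (fun x : ℝ => Real.log (1 - x)) (Set.Ioo (-1) 1) :=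
    ContDiffOn.log (by fun_prop) fun x hx => by linarith [hx.2]
  unfold Hfun binEnt
  fun_prop

/-- The second-order Taylor expansion of `Hfun` at a maximizer, in Peano form. -/
lemma tendsto_Hfun_sub_div_sq {p : ℕ} {β h m : ℝ} (hm : isMaximizer p β h m) :
    Tendsto (fun x => (Hfun p β h x - Hfun p β h m -
        iteratedDeriv 2 (Hfun p β h) m / 2 * (x - m) ^ 2) / (x - m) ^ 2) (𝓝 m) (𝓝 0) := by
  have hnhds : Set.Ioo (-1 : ℝ) 1 ∈ 𝓝 m := isOpen_Ioo.mem_nhds hm.1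
  have hmax : IsLocalMax (Hfun p β h) m := by
    filter_upwards [hnhds] with x hx using hm.2 x (Set.Ioo_subset_Icc_self hx)
  have ht := Real.taylor_tendsto (convex_Ioo (-1 : ℝ) 1) hm.1 (contDiffOn_Hfun p β h)
  rw [isOpen_Ioo.nhdsWithin_eq hm.1] at ht
  refine ht.congr fun x => ?_
  rw [taylorWithinEval_succ, taylorWithinEval_succ, taylor_within_zero_eval,
    iteratedDerivWithin_of_isOpen isOpen_Ioo hm.1, iteratedDerivWithin_of_isOpen isOpen_Ioo hm.1]
  norm_num [iteratedDeriv_one, hmax.deriv_eq_zero]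
  ring

lemma exists_Hfun_one_lt (p : ℕ) (β h : ℝ) :
    ∃ x ∈ Set.Ioo (-1 : ℝ) 1, Hfun p β h 1 < Hfun p β h x := by
  have hlog : Tendsto (fun x : ℝ => Real.log (1 - x)) (𝓝[<] 1) atBot := by
    refine Real.tendsto_log_nhdsGT_zero.comp ?_
    refine tendsto_nhdsWithin_iff.2 ⟨?_, ?_⟩
    · refine Tendsto.mono_left ?_ nhdsWithin_le_nhds
      exact Continuous.tendsto' (by fun_prop) _ _ (by norm_num)
    · filter_upwards [self_mem_nhdsWithin] with x hx
      simpa using hx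
  have hd : Tendsto (fun x : ℝ => (β * (p * x ^ (p - 1)) + h - Real.log (1 + x) / 2) +
      Real.log (1 - x) / 2) (𝓝[<] 1) atBot := by
    refine Tendsto.add_atBot (C := β * (p * 1 ^ (p - 1)) + h - Real.log (1 + 1) / 2) ?_
      (hlog.atBot_div_const two_pos)
    refine Tendsto.mono_left (ContinuousAt.tendsto ?_) nhdsWithin_le_nhds
    have : ContinuousAt (fun x : ℝ => Real.log (1 + x)) 1 :=
      ContinuousAt.log (by fun_prop) (by norm_num)
    fun_prop
  obtain ⟨a, ha, hneg⟩ := (mem_nhdsLT_iff_exists_Ioo_subset' (show (-1 : ℝ) < 1 by norm_num)).1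
    ((hd.eventually_lt_atBot 0).and (Ioo_mem_nhdsLT (show (-1 : ℝ) < 1 by norm_num)))
  set b := (max a (-1) + 1) / 2
  have ha1 : a < 1 := ha
  have hb : max a (-1) < 1 := max_lt ha1 (by norm_num)
  have hab : a < b := by linarith [le_max_left a (-1), show b = (max a (-1) + 1) / 2 from rfl]
  have hb1 : -1 < b := by linarith [le_max_right a (-1), show b = (max a (-1) + 1) / 2 from rfl]
  have hb2 : b < 1 := by linarith [show b = (max a (-1) + 1) / 2 from rfl]
  have hanti : StrictAntiOn (Hfun p β h) (Set.Icc b 1) := by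
    refine strictAntiOn_of_deriv_neg (convex_Icc b 1) (continuous_Hfun p β h).continuousOn ?_
    intro x hx
    rw [interior_Icc] at hx
    have := hneg (show x ∈ Set.Ioo a 1 from ⟨hab.trans hx.1, hx.2⟩)
    rw [(hasDerivAt_Hfun p β h this.2).deriv]
    have h0 := this.1
    linarith
  exact ⟨b, ⟨hb1, hb2⟩, hanti ⟨le_rfl, hb2.le⟩ ⟨hb2.le, le_rfl⟩ hb2⟩

lemma Hfun_neg (p : ℕ) (β h x : ℝ) : Hfun p β h (-x) = Hfun p (β * (-1) ^ p) (-h) x := by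
  rw [Hfun, Hfun, binEnt, binEnt, neg_pow]
  simp only [sub_neg_eq_add, ← sub_eq_add_neg]
  ring

lemma Hfun_lt_of_ne {p : ℕ} {β h m x : ℝ} (hm : isUniqueMaximizer p β h m)
    (hx : x ∈ Set.Icc (-1 : ℝ) 1) (hne : x ≠ m) : Hfun p β h x < Hfun p β h m := by
  rcases eq_or_lt_of_le hx.2 with rfl | h1
  · obtain ⟨y, hy, hlt⟩ := exists_Hfun_one_lt p β h
    exact hlt.trans_le (hm.1.2 y (Set.Ioo_subset_Icc_self hy))
  rcases eq_or_lt_of_le hx.1 with rfl | h2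
  · obtain ⟨y, hy, hlt⟩ := exists_Hfun_one_lt p (β * (-1) ^ p) (-h)
    rw [← Hfun_neg, ← Hfun_neg] at hlt
    exact hlt.trans_le (hm.1.2 (-y) ⟨by linarith [hy.2], by linarith [hy.1]⟩)
  · refine lt_of_le_of_ne (hm.1.2 x hx) fun heq => hne (hm.2 x ⟨⟨h2, h1⟩, fun y hy => ?_⟩)
    rw [heq]
    exact hm.1.2 y hy

lemma exists_Hfun_sub_le_neg_mul_sq {p : ℕ} {β h m : ℝ} (hreg : pRegular p β h m) :
    ∃ c > 0, ∀ x ∈ Set.Icc (-1 : ℝ) 1, Hfun p β h x - Hfun p β h m ≤ -c * (x - m) ^ 2 := by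
  obtain ⟨hm, hneg⟩ := hreg
  set a := iteratedDeriv 2 (Hfun p β h) m
  have hev := (tendsto_Hfun_sub_div_sq hm.1).eventually_lt_const (show 0 < -a / 4 by linarith)
  obtain ⟨δ, hδ, hnear⟩ := Metric.eventually_nhds_iff.1 hev
  have hK : IsCompact (Set.Icc (-1 : ℝ) 1 \ Metric.ball m δ) :=
    isCompact_Icc.diff Metric.isOpen_ball
  obtain ⟨η, hη, hfar⟩ : ∃ η > 0, ∀ x ∈ Set.Icc (-1 : ℝ) 1 \ Metric.ball m δ,
      Hfun p β h x - Hfun p β h m ≤ -η := by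
    rcases (Set.Icc (-1 : ℝ) 1 \ Metric.ball m δ).eq_empty_or_nonempty with he | hne
    · exact ⟨1, one_pos, by simp [he]⟩
    · obtain ⟨y, hy, hmax⟩ := hK.exists_isMaxOn hne (continuous_Hfun p β h).continuousOn
      have hym : y ≠ m := by
        rintro rfl
        exact hy.2 (Metric.mem_ball_self hδ)
      have := Hfun_lt_of_ne hm hy.1 hym
      exact ⟨Hfun p β h m - Hfun p β h y, by linarith, fun x hx => by
        have : Hfun p β h x ≤ Hfun p β h y := hmax hx
        linarith⟩
  refine ⟨min (-a / 4) (η / 4), by apply lt_min <;> linarith, fun x hx => ?_⟩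
  have hsq : (x - m) ^ 2 ≤ 4 := by nlinarith [hx.1, hx.2, hm.1.1.1, hm.1.1.2]
  by_cases hxd : x ∈ Metric.ball m δ
  · rcases eq_or_ne x m with rfl | hxm
    · simp
    have hpos : 0 < (x - m) ^ 2 := by
      have := sub_ne_zero.2 hxm
      positivity
    have h1 := hnear hxd
    rw [div_lt_iff₀ hpos] at h1
    nlinarith [min_le_left (-a / 4) (η / 4)]
  · have h1 := hfar x ⟨hx, hxd⟩
    nlinarith [min_le_right (-a / 4) (η / 4), sq_nonneg (x - m)]

/-- The function equal to `a * g k` where `k ≤ a * t + b < k + 1` for some natural `k < n`. -/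
def affineStep (n : ℕ) (g : ℕ → ℝ) (a b t : ℝ) : ℝ :=
  ∑ k ∈ Finset.range n, (Set.Ico ((k - b) / a) ((k + 1 - b) / a)).indicator (fun _ => a * g k) t

lemma measurable_affineStep (n : ℕ) (g : ℕ → ℝ) (a b : ℝ) : Measurable (affineStep n g a b) := by
  unfold affineStep
  exact Finset.measurable_fun_sum _ fun k _ => measurable_const.indicator measurableSet_Ico

lemma integral_affineStep (n : ℕ) (g : ℕ → ℝ) {a : ℝ} (ha : 0 < a) (b : ℝ) :
    ∫ t, affineStep n g a b t = ∑ k ∈ Finset.range n, g k := by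
  unfold affineStep
  rw [integral_finsetSum]
  · refine Finset.sum_congr rfl fun k _ => ?_
    have hlen : (k + 1 - b) / a - (k - b) / a = 1 / a := by ring
    rw [integral_indicator_const _ measurableSet_Ico, Real.volume_real_Ico, hlen,
      max_eq_left (by positivity), smul_eq_mul]
    field_simp
  · intro k _
    exact (integrable_indicator_iff measurableSet_Ico).2
      (integrableOn_const measure_Ico_lt_top.ne)

lemma affineStep_eq {n : ℕ} (g : ℕ → ℝ) {a b t : ℝ} (ha : 0 < a) :
    affineStep n g a b t =
      if 0 ≤ a * t + b ∧ ⌊a * t + b⌋₊ < n then a * g ⌊a * t + b⌋₊ else 0 := by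
  have hmem : ∀ k : ℕ, t ∈ Set.Ico ((k - b) / a) ((k + 1 - b) / a) ↔
      0 ≤ a * t + b ∧ ⌊a * t + b⌋₊ = k := by
    intro k
    rw [Set.mem_Ico, div_le_iff₀ ha, lt_div_iff₀ ha]
    constructor
    · rintro ⟨h1, h2⟩
      have hk : (0 : ℝ) ≤ k := k.cast_nonneg
      have h0 : 0 ≤ a * t + b := by linarith
      exact ⟨h0, (Nat.floor_eq_iff h0).2 ⟨by linarith, by linarith⟩⟩
    · rintro ⟨h0, hk⟩
      have := (Nat.floor_eq_iff h0).1 hk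
      exact ⟨by linarith [this.1], by linarith [this.2]⟩
  simp only [affineStep, Set.indicator_apply, hmem]
  by_cases h0 : 0 ≤ a * t + b
  · simp [h0]
  · simp [h0]

lemma sqrt_mul_meanMag_floor_mem {N : ℕ} (hN : 0 < N) {m t : ℝ}
    (ht : 0 ≤ √N / 2 * t + N * (1 + m) / 2) :
    √N * (meanMag N ⌊√N / 2 * t + N * (1 + m) / 2⌋₊ - m) ∈ Set.Icc (t - 2 / √N) t := by
  set u := √N / 2 * t + N * (1 + m) / 2 with hu
  have hN' : (0 : ℝ) < N := by exact_mod_cast hN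
  have hr : 0 < √(N : ℝ) := Real.sqrt_pos.2 hN'
  have hrr : √(N : ℝ) * √N = N := Real.mul_self_sqrt hN'.le
  have heq : √N * (meanMag N ⌊u⌋₊ - m) = t - 2 * (u - ⌊u⌋₊) / √N := by
    rw [hu, meanMag]
    generalize (⌊√(N : ℝ) / 2 * t + N * (1 + m) / 2⌋₊ : ℝ) = f
    generalize √(N : ℝ) = r at hr hrr ⊢
    rw [← hrr]
    field_simp
    ring
  rw [heq]
  have h1 := Nat.floor_le ht
  have h2 := Nat.lt_floor_add_one u
  constructor
  · gcongr
    linarith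
  · have : 0 ≤ 2 * (u - ⌊u⌋₊) / √N := by
      apply div_nonneg _ hr.le
      linarith
    linarith

lemma meanMag_mem_Icc {N k : ℕ} (hN : 0 < N) (hk : k ≤ N) :
    meanMag N k ∈ Set.Icc (-1 : ℝ) 1 := by
  have hN' : (0 : ℝ) < N := by exact_mod_cast hN
  have hk' : (k : ℝ) ≤ N := by exact_mod_cast hk
  unfold meanMag
  constructor
  · have : 0 ≤ 2 * (k : ℝ) / N := by positivity
    linarith
  · have : 2 * (k : ℝ) / N ≤ 2 := by
      rw [div_le_iff₀ hN']
      linarith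
    linarith

lemma eventually_sqrt_mul_binomPeak_mul_exp_le {G : ℝ → ℝ} {c m : ℝ} (hc : 0 < c)
    (hm : m ∈ Set.Ioo (-1 : ℝ) 1) (hG : ∀ x ∈ Set.Icc (-1 : ℝ) 1, G x ≤ -c * (x - m) ^ 2) :
    ∃ C, ∀ᶠ N : ℕ in atTop, ∀ k ≤ N, √N * (binomPeak N k * Real.exp (N * G (meanMag N k))) ≤
      C * Real.exp (-(c / 2) * (√N * (meanMag N k - m)) ^ 2) := by
  obtain ⟨A, hA⟩ : ∃ A, A = √π / (√π * √π) * √(2 / (1 - m ^ 2)) := ⟨_, rfl⟩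
  have hA0 : 0 ≤ A := by rw [hA]; positivity
  have hlim := tendsto_sqrt_mul_binomPeak
    (l := (atTop ×ˢ 𝓝 m).comap fun q : ℕ × ℕ => (q.1, meanMag q.1 q.2))
    (N := Prod.fst) (k := Prod.snd) hm
    ((tendsto_fst (g := 𝓝 m)).comp tendsto_comap) ((tendsto_snd (f := atTop)).comp tendsto_comap)
  rw [← hA] at hlim
  have hev := hlim.eventually_lt_const (show A < A + 1 by linarith)
  obtain ⟨s, hs, hsub⟩ := mem_comap.1 hev
  obtain ⟨P, hP, Q, hQ, hPQ⟩ := eventually_prod_iff.1 hs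
  obtain ⟨δ, hδ, hQδ⟩ := Metric.eventually_nhds_iff.1 hQ
  have hexp : Tendsto (fun N : ℕ => √N * Real.exp (-(c * δ ^ 2 / 2) * N)) atTop (𝓝 0) := by
    have := (tendsto_rpow_mul_exp_neg_mul_atTop_nhds_zero (1 / 2) (c * δ ^ 2 / 2)
      (by positivity)).comp tendsto_natCast_atTop_atTop
    refine this.congr fun N => ?_
    simp [Real.sqrt_eq_rpow]
  refine ⟨A + 1, ?_⟩
  filter_upwards [hP, eventually_gt_atTop 0, hexp.eventually_lt_const one_pos]
    with N hPN hN0 hNexp k hk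
  have hsI := meanMag_mem_Icc hN0 hk
  set x := meanMag N k with hx
  have hN' : (0 : ℝ) < N := by exact_mod_cast hN0
  have hrr : (√(N : ℝ)) ^ 2 = N := Real.sq_sqrt hN'.le
  have hb0 := binomPeak_nonneg hk
  have hGx : N * G x ≤ N * (-c * (x - m) ^ 2) := mul_le_mul_of_nonneg_left (hG x hsI) hN'.le
  rw [mul_pow, hrr]
  by_cases hd : dist x m < δ
  · have h1 : √N * binomPeak N k < A + 1 := @hsub (N, k) (hPQ hPN (hQδ hd))
    rw [← mul_assoc]
    have h2 : 0 ≤ c * (N * (x - m) ^ 2) := by positivity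
    exact mul_le_mul h1.le (Real.exp_le_exp.2 (by linarith)) (Real.exp_pos _).le (by linarith)
  · have hd' : δ ^ 2 ≤ (x - m) ^ 2 := by
      rw [not_lt, Real.dist_eq] at hd
      rw [← sq_abs (x - m)]
      gcongr
    have h2 : N * G x ≤ -(c * δ ^ 2 / 2) * N + -(c / 2) * (N * (x - m) ^ 2) := by
      have : c / 2 * N * δ ^ 2 ≤ c / 2 * N * (x - m) ^ 2 := by gcongr
      linarith
    calc √N * (binomPeak N k * Real.exp (N * G x))
        ≤ √N * (1 * Real.exp (-(c * δ ^ 2 / 2) * N + -(c / 2) * (N * (x - m) ^ 2))) := by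
          gcongr
          exact binomPeak_le_one hN0 hk
      _ = (√N * Real.exp (-(c * δ ^ 2 / 2) * N)) * Real.exp (-(c / 2) * (N * (x - m) ^ 2)) := by
          rw [Real.exp_add]
          ring
      _ ≤ (A + 1) * Real.exp (-(c / 2) * (N * (x - m) ^ 2)) := by
          gcongr
          linarith

/-- Laplace's method for sums of `binomPeak` weights against a bounded test function. -/
lemma tendsto_sum_binomPeak_mul_exp {G χ : ℝ → ℝ} {a c m : ℝ} (hc : 0 < c)
    (hm : m ∈ Set.Ioo (-1 : ℝ) 1) (hG : ∀ x ∈ Set.Icc (-1 : ℝ) 1, G x ≤ -c * (x - m) ^ 2)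
    (hGm : G m = 0)
    (hT : Tendsto (fun x => (G x - a * (x - m) ^ 2) / (x - m) ^ 2) (𝓝 m) (𝓝 0))
    (hχ : ∀ t, |χ t| ≤ 1) (hχc : ∀ᵐ t, ContinuousAt χ t) :
    Tendsto (fun N : ℕ => ∑ k ∈ Finset.range (N + 1),
        binomPeak N k * Real.exp (N * G (meanMag N k)) * χ (√N * (meanMag N k - m))) atTop
      (𝓝 (∫ t, √π / (√π * √π) * √(2 / (1 - m ^ 2)) / 2 * (Real.exp (a * t ^ 2) * χ t))) := by
  set A := √π / (√π * √π) * √(2 / (1 - m ^ 2)) with hA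
  set g : ℕ → ℕ → ℝ := fun N k =>
    binomPeak N k * Real.exp (N * G (meanMag N k)) * χ (√N * (meanMag N k - m)) with hg
  obtain ⟨C, hC⟩ := eventually_sqrt_mul_binomPeak_mul_exp_le hc hm hG
  have hsum : ∀ᶠ N : ℕ in atTop, ∫ t, affineStep (N + 1) (g N) (√N / 2) (N * (1 + m) / 2) t =
      ∑ k ∈ Finset.range (N + 1), g N k := by
    filter_upwards [eventually_gt_atTop 0] with N hN
    exact integral_affineStep _ _ (by positivity) _
  refine Tendsto.congr' hsum ?_
  refine tendsto_integral_filter_of_dominated_convergence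
    (fun t => |C| * Real.exp (2 * c) / 2 * Real.exp (-(c / 4) * t ^ 2))
    (Eventually.of_forall fun N => (measurable_affineStep _ _ _ _).aestronglyMeasurable) ?_
    ((integrable_exp_neg_mul_sq (by positivity)).const_mul _) ?_
  · filter_upwards [hC, eventually_gt_atTop 0] with N hCN hN
    refine Eventually.of_forall fun t => ?_
    have hN' : (0 : ℝ) < N := by exact_mod_cast hN
    have hr1 : 1 ≤ √(N : ℝ) := Real.one_le_sqrt.2 (by exact_mod_cast hN)
    rw [affineStep_eq _ (by positivity)]
    split_ifs with hcond
    · obtain ⟨h0, hlt⟩ := hcond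
      have hmem := sqrt_mul_meanMag_floor_mem hN h0
      set k := ⌊√N / 2 * t + N * (1 + m) / 2⌋₊
      have hk : k ≤ N := Nat.lt_succ_iff.1 hlt
      have hb := hCN k hk
      set w := √N * (meanMag N k - m) with hw
      have hnn : 0 ≤ binomPeak N k * Real.exp (N * G (meanMag N k)) :=
        mul_nonneg (binomPeak_nonneg hk) (Real.exp_pos _).le
      have h2 : 2 / √(N : ℝ) ≤ 2 := div_le_self (by norm_num) hr1
      have hwt : -(c / 2) * w ^ 2 ≤ 2 * c + -(c / 4) * t ^ 2 := by
        have hsq : t ^ 2 ≤ 2 * w ^ 2 + 8 := by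
          nlinarith [sq_nonneg (2 * w - t), hmem.1, hmem.2]
        nlinarith
      calc ‖√N / 2 * g N k‖
          = √N * (binomPeak N k * Real.exp (N * G (meanMag N k))) / 2 * |χ w| := by
            rw [Real.norm_eq_abs, abs_mul, abs_of_nonneg (by positivity), hg, abs_mul,
              abs_of_nonneg hnn]
            ring
        _ ≤ C * Real.exp (-(c / 2) * w ^ 2) / 2 * 1 := by
            gcongr
            · exact (by positivity : (0 : ℝ) ≤ _).trans (div_le_div_of_nonneg_right hb two_pos.le)
            · exact hχ w
        _ ≤ |C| * Real.exp (2 * c + -(c / 4) * t ^ 2) / 2 := by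
            rw [mul_one]
            gcongr
            exact le_abs_self C
        _ = _ := by
            rw [Real.exp_add]
            ring
    · rw [norm_zero]
      positivity
  · filter_upwards [hχc] with t ht
    have hNr : Tendsto (fun N : ℕ => (N : ℝ)) atTop atTop := tendsto_natCast_atTop_atTop
    have hsq : Tendsto (fun N : ℕ => √(N : ℝ)) atTop atTop := Real.tendsto_sqrt_atTop.comp hNr
    set u : ℕ → ℝ := fun N => √N / 2 * t + N * (1 + m) / 2 with hu
    have hlow : ∀ b : ℝ, 0 < b → Tendsto (fun N : ℕ => √N * (t / 2 + √N * b)) atTop atTop :=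
      fun b hb => hsq.atTop_mul_atTop₀
        (tendsto_atTop_add_const_left _ _ (hsq.atTop_mul_const hb))
    have hu0 : ∀ᶠ N : ℕ in atTop, 0 ≤ u N := by
      filter_upwards [(hlow ((1 + m) / 2) (by linarith [hm.1])).eventually_ge_atTop 0] with N hN
      have hrr : √(N : ℝ) * √N = N := Real.mul_self_sqrt N.cast_nonneg
      rw [hu]
      dsimp only
      linear_combination hN + (1 + m) / 2 * hrr
    have huN : ∀ᶠ N : ℕ in atTop, ⌊u N⌋₊ < N + 1 := by
      have : Tendsto (fun N : ℕ => √N * (-t / 2 + √N * ((1 - m) / 2))) atTop atTop :=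
        hsq.atTop_mul_atTop₀ (tendsto_atTop_add_const_left _ _
          (hsq.atTop_mul_const (by linarith [hm.2])))
      filter_upwards [this.eventually_ge_atTop 0] with N hN
      have hrr : √(N : ℝ) * √N = N := Real.mul_self_sqrt N.cast_nonneg
      refine Nat.lt_succ_iff.2 (Nat.floor_le_of_le ?_)
      rw [hu]
      dsimp only
      linear_combination hN + (1 - m) / 2 * hrr
    have hw : Tendsto (fun N : ℕ => √N * (meanMag N ⌊u N⌋₊ - m)) atTop (𝓝 t) := by
      refine tendsto_of_tendsto_of_tendsto_of_le_of_le'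
        (g := fun N : ℕ => t - 2 / √N) (h := fun _ => t) ?_ tendsto_const_nhds ?_ ?_
      · simpa using (tendsto_const_nhds (x := t)).sub (hsq.const_div_atTop 2)
      · filter_upwards [hu0, eventually_gt_atTop 0] with N h0 hN
        exact (sqrt_mul_meanMag_floor_mem hN h0).1
      · filter_upwards [hu0, eventually_gt_atTop 0] with N h0 hN
        exact (sqrt_mul_meanMag_floor_mem hN h0).2
    have hs : Tendsto (fun N : ℕ => meanMag N ⌊u N⌋₊) atTop (𝓝 m) := by
      have := (hw.mul (hsq.inv_tendsto_atTop)).add_const m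
      simp only [mul_zero, zero_add] at this
      refine this.congr' ?_
      filter_upwards [eventually_gt_atTop 0] with N hN
      have hr : √(N : ℝ) ≠ 0 := by positivity
      simp only [Pi.inv_apply]
      field_simp
      ring
    have hpeak := tendsto_sqrt_mul_binomPeak hm tendsto_id hs
    rw [← hA] at hpeak
    have hGlim : Tendsto (fun N : ℕ => N * G (meanMag N ⌊u N⌋₊)) atTop (𝓝 (a * t ^ 2)) := by
      have := ((hT.comp hs).mul (hw.pow 2)).add ((hw.pow 2).const_mul a)
      rw [zero_mul, zero_add] at this
      refine this.congr fun N => ?_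
      have hrr : √(N : ℝ) ^ 2 = N := Real.sq_sqrt N.cast_nonneg
      simp only [Function.comp, mul_pow, hrr]
      rcases eq_or_ne (meanMag N ⌊u N⌋₊) m with he | he
      · simp [he, hGm]
      · have := sub_ne_zero.2 he
        field_simp
        ring
    have hχlim : Tendsto (fun N : ℕ => χ (√N * (meanMag N ⌊u N⌋₊ - m))) atTop (𝓝 (χ t)) :=
      ht.tendsto.comp hw
    have hexp := (Real.continuous_exp.tendsto _).comp hGlim
    refine Tendsto.congr' ?_ ((hpeak.div_const 2).mul (hexp.mul hχlim))
    filter_upwards [hu0, huN, eventually_gt_atTop 0] with N h0 h1 hN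
    rw [affineStep_eq _ (by positivity), if_pos ⟨h0, h1⟩]
    simp only [hg, hu, Function.comp, id]
    ring

lemma cwProb_setOf_le_eq {p N : ℕ} (hN : 0 < N) (β h m x : ℝ) :
    cwProb p N β h {σ | (mag σ - N * m) / √N ≤ x} =
      (∑ k ∈ Finset.range (N + 1), binomPeak N k *
          Real.exp (N * (Hfun p β h (meanMag N k) - Hfun p β h m)) *
          (Set.Iic x).indicator (fun _ => 1) (√N * (meanMag N k - m))) /
        ∑ k ∈ Finset.range (N + 1), binomPeak N k *
          Real.exp (N * (Hfun p β h (meanMag N k) - Hfun p β h m)) * 1 := by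
  have hN' : (0 : ℝ) < N := by exact_mod_cast hN
  have key : ∀ χ : ℝ → ℝ, ∑ σ : Fin N → Bool, cwWeight p N β h σ * χ ((mag σ - N * m) / √N) =
      2 ^ N * Real.exp (N * Hfun p β h m) * ∑ k ∈ Finset.range (N + 1), binomPeak N k *
          Real.exp (N * (Hfun p β h (meanMag N k) - Hfun p β h m)) *
          χ (√N * (meanMag N k - m)) := by
    intro χ
    simp only [cwWeight, cwHamiltonian_eq hN]
    rw [sum_apply_mag N fun M => Real.exp (N * (β * (M / N) ^ p + h * (M / N))) *
      χ ((M - N * m) / √N), Finset.mul_sum]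
    refine Finset.sum_congr rfl fun k hk => ?_
    have hrr : √(N : ℝ) * √N = N := Real.mul_self_sqrt hN'.le
    have h1 : (2 * k - N : ℝ) / N = meanMag N k := by
      unfold meanMag
      field_simp
    have h2 : (2 * k - N - N * m : ℝ) / √N = √N * (meanMag N k - m) := by
      rw [← h1, div_eq_iff (by positivity), mul_right_comm, hrr]
      field_simp
    rw [h1, h2, ← mul_assoc, choose_mul_exp_eq hN (Finset.mem_range_succ_iff.1 hk) β h m]
    ring
  have hnum : ∀ σ : Fin N → Bool,
      ({σ | (mag σ - N * m) / √N ≤ x} : Set (Fin N → Bool)).indicator (cwWeight p N β h) σ =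
        cwWeight p N β h σ * (Set.Iic x).indicator (fun _ => 1) ((mag σ - N * m) / √N) := by
    intro σ
    simp [Set.indicator_apply]
  have hden := key fun _ => 1
  simp only [mul_one] at hden
  simp only [cwProb, hnum, key, mul_one, hden]
  rw [mul_div_mul_left]
  positivity

/-- **CLT for the magnetization at `p`-regular points.** -/
theorem clt_regular
    (p : ℕ) (hp : 3 ≤ p) (β h m : ℝ) (hβ : 0 < β) (hh : 0 < h)
    (hreg : pRegular p β h m) :
    ∀ x : ℝ,
      Tendsto (fun N : ℕ =>
          cwProb p N β h {σ | (mag σ - N * m) / Real.sqrt N ≤ x})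
        atTop (𝓝 (gaussCDF (-1 / iteratedDeriv 2 (Hfun p β h) m) x)) := by
  intro x
  obtain ⟨c, hc, hG⟩ := exists_Hfun_sub_le_neg_mul_sq hreg
  have hm := hreg.1.1
  have hneg := hreg.2
  have hT := tendsto_Hfun_sub_div_sq hm
  set a := iteratedDeriv 2 (Hfun p β h) m with ha
  obtain ⟨A, hA⟩ : ∃ A, A = √π / (√π * √π) * √(2 / (1 - m ^ 2)) / 2 := ⟨_, rfl⟩
  have hA0 : 0 < A := by
    have : 0 < 1 - m ^ 2 := by nlinarith [hm.1.1, hm.1.2]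
    rw [hA]
    positivity
  have hnum := tendsto_sum_binomPeak_mul_exp (χ := (Set.Iic x).indicator fun _ => 1)
    hc hm.1 hG (sub_self _) hT
    (fun t => by by_cases h : t ≤ x <;> simp [h])
    (by
      filter_upwards [compl_mem_ae_iff.2 (measure_singleton x)] with t ht
      rcases lt_or_gt_of_ne (show t ≠ x from ht) with h | h
      · refine (continuousAt_const (y := (1 : ℝ))).congr ?_
        filter_upwards [Iio_mem_nhds h] with y hy
        simp [le_of_lt (show y < x from hy)]
      · refine (continuousAt_const (y := (0 : ℝ))).congr ?_
        filter_upwards [Ioi_mem_nhds h] with y hy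
        simp [show x < y from hy])
  have hden := tendsto_sum_binomPeak_mul_exp (χ := fun _ => 1) hc hm.1 hG (sub_self _) hT
    (fun t => by simp) (Eventually.of_forall fun t => continuousAt_const)
  rw [← hA, integral_const_mul] at hnum hden
  have hgauss : ∫ t : ℝ, Real.exp (a / 2 * t ^ 2) * 1 = √(2 * π * (-1 / a)) := by
    have := integral_gaussian (-a / 2)
    rw [show π / (-a / 2) = 2 * π * (-1 / a) by field_simp] at this
    rw [← this]
    refine integral_congr_ae (Eventually.of_forall fun t => ?_)
    dsimp only
    rw [mul_one]
    congr 1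
    ring
  have hind : ∫ t : ℝ, Real.exp (a / 2 * t ^ 2) * (Set.Iic x).indicator (fun _ => 1) t =
      ∫ t in Set.Iic x, Real.exp (-t ^ 2 / (2 * (-1 / a))) := by
    rw [← integral_indicator measurableSet_Iic]
    refine integral_congr_ae (Eventually.of_forall fun t => ?_)
    have : -t ^ 2 / (2 * (-1 / a)) = a / 2 * t ^ 2 := by
      have := hneg.ne
      field_simp
    simp only [Set.indicator_apply, this]
    split_ifs <;> simp
  have hv : 0 < -1 / a := div_pos_of_neg_of_neg (by norm_num) hneg
  rw [hgauss] at hden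
  rw [hind] at hnum
  have hlim := hnum.div hden (by positivity)
  have hval : gaussCDF (-1 / a) x = A * (∫ t in Set.Iic x, Real.exp (-t ^ 2 / (2 * (-1 / a)))) /
      (A * √(2 * π * (-1 / a))) := by
    rw [gaussCDF, gaussProb, integral_const_mul, mul_div_mul_left _ _ hA0.ne', inv_mul_eq_div]
  rw [hval]
  refine hlim.congr' ?_
  filter_upwards [eventually_gt_atTop 0] with N hN
  exact (cwProb_setOf_le_eq hN β h m x).symm
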